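/- The supremum of a + k·m([c,1]) over all a ≥ 0, k ≥ 0, and c ∈ (0,1) satisfying a·δ + k·∫_c^1 F_ρ^{-1}(1-z) dz ≤ x equals max(1/δ, γ*)·x (with the convention that both sides equal +∞ when γ* = +∞). -/

import Mathlib

open MeasureTheory Set Filter Topology ENNReal

noncomputable section

/-- The CDF of a random variable `ρ` under the measure `μ`. -/
def cdfFun {Ω : Type*} [MeasurableSpace Ω] (μ : Measure Ω) (ρ : Ω → ℝ) : ℝ → ℝ :=
  fun t => (μ {ω | ρ ω ≤ t}).toReal

/-- The right-continuous quantile function of `ρ`: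
`F_ρ⁻¹(z) = inf {t : F_ρ(t) > z}`. -/
def rcInv {Ω : Type*} [MeasurableSpace Ω] (μ : Measure Ω) (ρ : Ω → ℝ) : ℝ → ℝ :=
  fun z => sInf {t : ℝ | z < cdfFun μ ρ t}

/-- A feasible quantile function for pricing-density `F = F_ρ⁻¹` and initial wealth `x`:
nondecreasing and right-continuous on `(0,1)`, with `lim_{z↓0} G(z) ≥ 0`, satisfying the
budget constraint `∫_0^1 F(1-z) G(z) dz ≤ x`. -/
def Feasible (F : ℝ → ℝ) (x : ℝ) (G : ℝ → ℝ) : Prop :=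
  MonotoneOn G (Set.Ioo 0 1)
  ∧ (∀ z ∈ Set.Ioo (0:ℝ) 1, Filter.Tendsto G (nhdsWithin z (Set.Ioi z)) (nhds (G z)))
  ∧ (∃ L, 0 ≤ L ∧ Filter.Tendsto G (nhdsWithin 0 (Set.Ioi 0)) (nhds L))
  ∧ ∫⁻ z in Set.Ioo (0:ℝ) 1, ENNReal.ofReal (F (1 - z) * G z) ≤ ENNReal.ofReal x

/-- The extension `Ḡ` of a (nonnegative) quantile function `G` from `(0,1)` to `[0,1]`,
valued in `[0,∞]`, with `Ḡ(0) = lim_{z↓0} G(z)` and `Ḡ(1) = lim_{z↑1} G(z)`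
(these limits are the inf/sup over `(0,1)` since `G` is nondecreasing). -/
def Gbar (G : ℝ → ℝ) : ℝ → ℝ≥0∞ := fun z =>
  if z = 0 then ⨅ y ∈ Set.Ioo (0:ℝ) 1, ENNReal.ofReal (G y)
  else if z = 1 then ⨆ y ∈ Set.Ioo (0:ℝ) 1, ENNReal.ofReal (G y)
  else ENNReal.ofReal (G z)

/-- The objective value `∫_{[0,1]} Ḡ(z) m(dz)` of a quantile function `G`
(for `m` a Borel probability measure carried by `[0,1]`). -/
def objVal (m : Measure ℝ) (G : ℝ → ℝ) : ℝ≥0∞ := ∫⁻ z, Gbar G z ∂m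

/-- `ζ(c) = m([c,1]) / ∫_c^1 F(1-z) dz`. -/
def zeta (F : ℝ → ℝ) (m : Measure ℝ) (c : ℝ) : ℝ :=
  (m (Set.Icc c 1)).toReal / ∫ z in c..1, F (1 - z)

theorem cdfFun_eq_cdf {Ω : Type*} [MeasurableSpace Ω] (μ : Measure Ω) [IsProbabilityMeasure μ]
    {ρ : Ω → ℝ} (hρ : Measurable ρ) : cdfFun μ ρ = ProbabilityTheory.cdf (μ.map ρ) := by
  have : IsProbabilityMeasure (μ.map ρ) := Measure.isProbabilityMeasure_map hρ.aemeasurable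
  ext t
  rw [ProbabilityTheory.cdf_eq_real, measureReal_def, Measure.map_apply hρ measurableSet_Iic]
  rfl

/-- The quantile function of a positive random variable with continuous CDF is positive
on `(0,1)`. -/
theorem rcInv_pos {Ω : Type*} [MeasurableSpace Ω] (μ : Measure Ω) [IsProbabilityMeasure μ]
    {ρ : Ω → ℝ} (hρ : Measurable ρ) (hpos : ∀ ω, 0 < ρ ω) (hcdf : Continuous (cdfFun μ ρ))
    {z : ℝ} (hz : z ∈ Set.Ioo (0:ℝ) 1) : 0 < rcInv μ ρ z := by
  have hzero : cdfFun μ ρ 0 = 0 := by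
    have : {ω | ρ ω ≤ 0} = ∅ := by
      ext ω
      simpa using hpos ω
    simp [cdfFun, this]
  have hmono : Monotone (cdfFun μ ρ) := by
    rw [cdfFun_eq_cdf μ hρ]
    exact ProbabilityTheory.monotone_cdf _
  have htop : Tendsto (cdfFun μ ρ) atTop (𝓝 1) := by
    rw [cdfFun_eq_cdf μ hρ]
    exact ProbabilityTheory.tendsto_cdf_atTop _
  have hlt : ∀ᶠ t in 𝓝 (0:ℝ), cdfFun μ ρ t < z :=
    hcdf.continuousAt.eventually_lt continuousAt_const (by simpa [hzero] using hz.1)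
  obtain ⟨ε, hε, hball⟩ := Metric.eventually_nhds_iff.1 hlt
  have hhalf : cdfFun μ ρ (ε / 2) < z := by
    apply hball
    rw [Real.dist_eq, sub_zero, abs_of_pos (half_pos hε)]
    exact half_lt_self hε
  have hne : {t : ℝ | z < cdfFun μ ρ t}.Nonempty := (htop.eventually_const_lt hz.2).exists
  refine (half_pos hε).trans_le (le_csInf hne fun t ht => ?_)
  exact (hmono.reflect_lt (hhalf.trans ht)).le

/-- the supremum of `a + k·m([c,1])` over all `a ≥ 0`, `k ≥ 0`, `c ∈ (0,1)`
with `a·δ + k·∫_c^1 F_ρ⁻¹(1-z) dz ≤ x` equals `max(1/δ, γ*)·x` (in `[0,∞]`; both sides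
are `+∞` when `γ* = +∞`). -/
theorem iSup_binary_eq_max
    {Ω : Type*} [MeasurableSpace Ω] (μ : Measure Ω) [IsProbabilityMeasure μ]
    (ρ : Ω → ℝ) (hρmeas : Measurable ρ) (hρpos : ∀ ω, 0 < ρ ω)
    (hρint : Integrable ρ μ) (hcdf : Continuous (cdfFun μ ρ))
    (m : Measure ℝ) [IsProbabilityMeasure m] (hm : m (Set.Icc (0:ℝ) 1)ᶜ = 0)
    (x δ : ℝ) (hx : 0 < x) (hδpos : 0 < δ)
    (hδ1 : δ = ∫ ω, ρ ω ∂μ) (hδ2 : δ = ∫ z in (0:ℝ)..1, rcInv μ ρ (1 - z)) :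
    (⨆ (p : ℝ × ℝ × ℝ) (_ : 0 ≤ p.1 ∧ 0 ≤ p.2.1 ∧ p.2.2 ∈ Set.Ioo (0:ℝ) 1
          ∧ p.1 * δ + p.2.1 * ∫ t in p.2.2..1, rcInv μ ρ (1 - t) ≤ x),
        ENNReal.ofReal (p.1 + p.2.1 * (m (Set.Icc p.2.2 1)).toReal))
      = max (ENNReal.ofReal (1 / δ))
          (⨆ c ∈ Set.Ioo (0:ℝ) 1, ENNReal.ofReal (zeta (rcInv μ ρ) m c)) * ENNReal.ofReal x := by
  have hint : IntervalIntegrable (fun z => rcInv μ ρ (1 - z)) volume 0 1 := by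
    by_contra h
    rw [intervalIntegral.integral_undef h] at hδ2
    exact hδpos.ne' hδ2
  have hD : ∀ c ∈ Set.Ioo (0:ℝ) 1, 0 < ∫ z in c..1, rcInv μ ρ (1 - z) := by
    intro c hc
    refine intervalIntegral.intervalIntegral_pos_of_pos_on (hint.mono_set ?_) ?_ hc.2
    · rw [uIcc_of_le hc.2.le, uIcc_of_le zero_le_one]
      exact Icc_subset_Icc_left hc.1.le
    · intro z hz
      exact rcInv_pos μ hρmeas hρpos hcdf ⟨by linarith [hz.2], by linarith [hz.1, hc.1]⟩
  apply le_antisymm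
  · refine iSup₂_le ?_
    rintro ⟨a, k, c⟩ ⟨ha, hk, hc, hbudget⟩
    dsimp only at ha hk hc hbudget ⊢
    have hDc := hD c hc
    have hbound : a + k * (m (Set.Icc c 1)).toReal
        ≤ max (1 / δ) (zeta (rcInv μ ρ) m c) * x := by
      have hm_eq : (m (Set.Icc c 1)).toReal
          = zeta (rcInv μ ρ) m c * ∫ z in c..1, rcInv μ ρ (1 - z) :=
        (div_mul_cancel₀ _ hDc.ne').symm
      have ha_eq : a = 1 / δ * (a * δ) := by field_simp
      have hmax : 0 ≤ max (1 / δ) (zeta (rcInv μ ρ) m c) :=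
        (one_div_pos.2 hδpos).le.trans (le_max_left _ _)
      calc a + k * (m (Set.Icc c 1)).toReal
          = 1 / δ * (a * δ)
            + zeta (rcInv μ ρ) m c * (k * ∫ z in c..1, rcInv μ ρ (1 - z)) := by
            rw [← ha_eq, hm_eq]; ring
        _ ≤ max (1 / δ) (zeta (rcInv μ ρ) m c) * (a * δ)
            + max (1 / δ) (zeta (rcInv μ ρ) m c)
              * (k * ∫ z in c..1, rcInv μ ρ (1 - z)) := by
            gcongr
            · exact le_max_left _ _
            · exact le_max_right _ _
        _ ≤ max (1 / δ) (zeta (rcInv μ ρ) m c) * x := by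
            rw [← mul_add]
            exact mul_le_mul_of_nonneg_left hbudget hmax
    refine (ENNReal.ofReal_le_ofReal hbound).trans ?_
    rw [ENNReal.ofReal_mul' hx.le, ENNReal.ofReal_max]
    gcongr
    exact le_iSup₂_of_le c hc le_rfl
  · rw [max_mul_of_nonneg _ _ zero_le, ENNReal.iSup_mul]
    refine max_le ?_ (iSup_le fun c => ?_)
    · refine le_iSup₂_of_le (x / δ, 0, 1 / 2) ⟨by positivity, le_rfl, by norm_num, ?_⟩ ?_
      · simp [div_mul_cancel₀ x hδpos.ne']
      · rw [← ENNReal.ofReal_mul' hx.le]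
        apply ENNReal.ofReal_le_ofReal
        simp [div_eq_inv_mul]
    · rw [ENNReal.iSup_mul]
      refine iSup_le fun hc => ?_
      have hDc := hD c hc
      refine le_iSup₂_of_le (0, x / ∫ z in c..1, rcInv μ ρ (1 - z), c)
        ⟨le_rfl, by positivity, hc, ?_⟩ ?_
      · simp only [zero_mul, zero_add, div_mul_cancel₀ x hDc.ne', le_refl]
      · rw [← ENNReal.ofReal_mul' hx.le]
        apply ENNReal.ofReal_le_ofReal
        apply le_of_eq
        simp only [zeta]
        ring
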